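/- (Optimal policy, net-zero zone, partial-charge segment.) Under strict A1, if σ⁻ᵒ < g < σ⁻, where σ⁻ᵒ := f(τγ) and σ⁻ := f(τγ) + ē, then the pair (d*, e*) with d*_k = f_k(τγ) for every k and e* = g − f(τγ) ∈ (0, ē) maximizes J over D × [−e̲, ē]; i.e., devices consume at the standalone optimum for the effective price τγ and the storage partially charges, with zero net consumption. -/

import Mathlib

open Set

/-- A two-rate payment is bounded below by any linear payment at an intermediate rate. -/
lemma mul_le_two_rate_payment {a b c : ℝ} (hac : a ≤ c) (hcb : c ≤ b) (z : ℝ) :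
    c * z ≤ b * max z 0 + a * min z 0 := by
  rcases le_total 0 z with hz | hz
  · rw [max_eq_left hz, min_eq_right hz]
    nlinarith
  · rw [max_eq_right hz, min_eq_left hz]
    nlinarith

/-- The salvage value of a storage action is at most its value at the charging rate. -/
lemma salvage_le_mul {tau gam rho : ℝ} (h : tau * gam ≤ gam / rho) (e : ℝ) :
    gam * (tau * max e 0 - max (-e) 0 / rho) ≤ tau * gam * e := by
  rcases le_total 0 e with he | he
  · rw [max_eq_left he, max_eq_right (neg_nonpos.2 he)]
    simp only [zero_div, sub_zero]
    exact le_of_eq (by ring)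
  · rw [max_eq_right he, max_eq_left (neg_nonneg.2 he)]
    have key : gam * (tau * 0 - -e / rho) = gam / rho * e := by ring
    rw [key]
    exact mul_le_mul_of_nonpos_right h he

theorem optimal_policy_net_zero_partial_charge
    (K : ℕ) (hK : 0 < K)
    (dbar : Fin K → ℝ) (hdbar : ∀ k, 0 < dbar k)
    (U : Fin K → ℝ → ℝ)
    (hconc : ∀ k, StrictConcaveOn ℝ (Icc 0 (dbar k)) (U k))
    (hmono : ∀ k, MonotoneOn (U k) (Icc 0 (dbar k)))
    (hC1 : ∀ k, ContDiffOn ℝ 1 (U k) (Icc 0 (dbar k)))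
    -- NEM X rates
    (pim pip : ℝ) (hpim : 0 ≤ pim) (hpi : pim ≤ pip)
    (P : ℝ → ℝ) (hP : ∀ z, P z = pip * max z 0 + pim * min z 0)
    -- storage parameters
    (elow ebar : ℝ) (helow : 0 ≤ elow) (hebar : 0 ≤ ebar)
    (tau rho : ℝ) (htau : tau ∈ Ioc (0:ℝ) 1) (hrho : rho ∈ Ioc (0:ℝ) 1)
    (gam : ℝ) (hgam : 0 ≤ gam)
    -- strict A1
    (hA1m : pim < tau * gam) (hA1p : gam / rho < pip)
    -- consumption set
    (D : Set (Fin K → ℝ)) (hD : D = univ.pi fun k => Icc 0 (dbar k))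
    -- `f k π` is the unique maximizer of `x ↦ U k x − π x` over `[0, dbar k]`
    (f : Fin K → ℝ → ℝ)
    (hf : ∀ k, ∀ π : ℝ, 0 ≤ π → f k π ∈ Icc 0 (dbar k) ∧
      (∀ x ∈ Icc 0 (dbar k), x ≠ f k π → U k x - π * x < U k (f k π) - π * f k π))
    -- renewable generation
    (g : ℝ) (hg : 0 ≤ g)
    -- storage-adjusted stage surplus
    (J : (Fin K → ℝ) → ℝ → ℝ)
    (hJ : ∀ d e, J d e = (∑ k, U k (d k)) - P ((∑ k, d k) + e - g)
        + gam * (tau * max e 0 - max (-e) 0 / rho))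
    -- σ⁻ᵒ < g < σ⁻, where σ⁻ᵒ = f(τγ) and σ⁻ = f(τγ) + ē
    (hzone₁ : (∑ k, f k (tau * gam)) < g) (hzone₂ : g < (∑ k, f k (tau * gam)) + ebar) :
    (g - (∑ k, f k (tau * gam)) ∈ Ioo 0 ebar) ∧
    (fun k => f k (tau * gam)) ∈ D ∧
    (∀ d ∈ D, ∀ e ∈ Icc (-elow) ebar,
      J d e ≤ J (fun k => f k (tau * gam)) (g - (∑ k, f k (tau * gam)))) ∧
    (∑ k, f k (tau * gam)) + (g - (∑ k, f k (tau * gam))) - g = 0 := by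
  have hc : 0 ≤ tau * gam := mul_nonneg htau.1.le hgam
  have hcg : tau * gam ≤ gam / rho :=
    (mul_le_of_le_one_left hgam htau.2).trans (le_div_self hgam hrho.1 hrho.2)
  refine ⟨⟨by linarith, by linarith⟩, ?_, ?_, by ring⟩
  · rw [hD]
    exact fun k _ => (hf k _ hc).1
  · intro d hd e _
    rw [hD] at hd
    have hdev : ∀ k, U k (d k) - tau * gam * d k ≤
        U k (f k (tau * gam)) - tau * gam * f k (tau * gam) := by
      intro k
      rcases eq_or_ne (d k) (f k (tau * gam)) with h | h
      · rw [h]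
      · exact ((hf k _ hc).2 _ (hd k (mem_univ k)) h).le
    have hsum := Finset.sum_le_sum fun k (_ : k ∈ Finset.univ) => hdev k
    simp only [Finset.sum_sub_distrib, ← Finset.mul_sum] at hsum
    have hpay := mul_le_two_rate_payment hA1m.le (hcg.trans hA1p.le) (∑ k, d k + e - g)
    have hsalv := salvage_le_mul hcg e
    rw [hJ, hJ, hP, hP, add_sub_cancel, sub_self,
      max_eq_left (sub_pos.2 hzone₁).le, max_eq_right (neg_nonpos.2 (sub_pos.2 hzone₁).le)]
    simp only [max_self, min_self, zero_div, sub_zero, mul_zero, add_zero]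
    linarith
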